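/- arXiv:2209.02993 — 4 statements merged into one kernel-verified Lean document; each statement's English description precedes it below -/
import Mathlib

section
/- The function V*_{1/2} satisfies the Caputo fractional initial value problem D^{3/2}_* V*_{1/2}(ξ) + (V*_{1/2})'(ξ) = 0 for all ξ > 0, together with V*_{1/2}(0) = 0 and (V*_{1/2})'(0) = 1 (the derivative at 0 taken from the right). Here D^{3/2}_* V*_{1/2}(ξ) is the explicit integral (1/Γ(1/2)) ∫_0^ξ (ξ − t)^{−1/2} (V*_{1/2})''(t) dt. -/
/-- `V*_{1/2}(ξ) = Σ_{k=1}^∞ ξ^k/k! − Σ_{k=1}^∞ ξ^{k+1/2}/Γ(k+3/2)`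
(sums written over `k : ℕ` with the index shifted by one;
`ξ ^ (k + 1/2)` is the real power `Real.rpow`). -/
noncomputable def Vstar (ξ : ℝ) : ℝ :=
  (∑' k : ℕ, ξ ^ (k + 1) / (Nat.factorial (k + 1) : ℝ)) -
  ∑' k : ℕ, ξ ^ (((k : ℝ) + 1) + 1 / 2) / Real.Gamma (((k : ℝ) + 1) + 3 / 2)

open MeasureTheory Filter Topology

noncomputable def EE (a x : ℝ) : ℝ := ∑' k : ℕ, x ^ ((k : ℝ) + a) / Real.Gamma ((k : ℝ) + a + 1)

lemma gpos {a : ℝ} (ha : -1 < a) (k : ℕ) : 0 < Real.Gamma ((k : ℝ) + a + 1) :=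
  Real.Gamma_pos_of_pos (by have : (0 : ℝ) ≤ k := k.cast_nonneg; linarith)

lemma EE_summable {a x : ℝ} (ha : -1 < a) (hx : 0 < x) :
    Summable (fun k : ℕ => x ^ ((k : ℝ) + a) / Real.Gamma ((k : ℝ) + a + 1)) := by
  have hp : ∀ k : ℕ, 0 < x ^ ((k : ℝ) + a) / Real.Gamma ((k : ℝ) + a + 1) := fun k =>
    div_pos (Real.rpow_pos_of_pos hx _) (gpos ha k)
  refine summable_of_ratio_test_tendsto_lt_one (l := 0) zero_lt_one
    (Eventually.of_forall fun k => (hp k).ne') ?_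
  have h1 : Tendsto (fun k : ℕ => x / ((k : ℝ) + (a + 1))) atTop (𝓝 0) :=
    (tendsto_atTop_add_const_right _ _ tendsto_natCast_atTop_atTop).const_div_atTop x
  refine h1.congr fun k => ?_
  rw [Real.norm_of_nonneg (hp _).le, Real.norm_of_nonneg (hp _).le]
  have hk : (0 : ℝ) < (k : ℝ) + a + 1 := by have : (0 : ℝ) ≤ k := k.cast_nonneg; linarith
  have e1 : ((k + 1 : ℕ) : ℝ) + a = ((k : ℝ) + a) + 1 := by push_cast; ring
  rw [e1, Real.Gamma_add_one hk.ne', Real.rpow_add hx, Real.rpow_one, ← add_assoc]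
  have := (gpos ha k).ne'
  have := (Real.rpow_pos_of_pos hx ((k : ℝ) + a)).ne'
  field_simp

lemma EE_pos {a x : ℝ} (ha : -1 < a) (hx : 0 < x) : 0 < EE a x := by
  have hp : ∀ k : ℕ, 0 < x ^ ((k : ℝ) + a) / Real.Gamma ((k : ℝ) + a + 1) := fun k =>
    div_pos (Real.rpow_pos_of_pos hx _) (gpos ha k)
  exact (EE_summable ha hx).tsum_pos (fun k => (hp k).le) 0 (hp 0)

lemma EE_zero (x : ℝ) : EE 0 x = Real.exp x := by
  have h := NormedSpace.expSeries_div_hasSum_exp x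
  rw [← Real.exp_eq_exp_ℝ] at h
  rw [← h.tsum_eq, EE]
  refine tsum_congr fun k => ?_
  rw [add_zero, Real.rpow_natCast, Real.Gamma_nat_eq_factorial]

lemma EE_hasDerivAt {a x : ℝ} (ha : -1 < a) (hx : 0 < x) :
    HasDerivAt (EE (a + 1)) (EE a x) x := by
  have hm : x ∈ Set.Ioo (x / 2) (2 * x) := ⟨by linarith, by linarith⟩
  refine hasDerivAt_tsum_of_isPreconnected
    (g := fun (k : ℕ) (y : ℝ) => y ^ ((k : ℝ) + (a + 1)) / Real.Gamma ((k : ℝ) + (a + 1) + 1))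
    (g' := fun (k : ℕ) (y : ℝ) => y ^ ((k : ℝ) + a) / Real.Gamma ((k : ℝ) + a + 1))
    (u := fun k : ℕ => (x / 2) ^ ((k : ℝ) + a) / Real.Gamma ((k : ℝ) + a + 1) +
      (2 * x) ^ ((k : ℝ) + a) / Real.Gamma ((k : ℝ) + a + 1))
    (t := Set.Ioo (x / 2) (2 * x)) (y₀ := x)
    ((EE_summable ha (by linarith)).add (EE_summable ha (by linarith)))
    isOpen_Ioo isPreconnected_Ioo ?_ ?_ hm (EE_summable (by linarith) hx) hm
  · intro k y hy
    have hy0 : 0 < y := by linarith [hy.1]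
    have hk : (0 : ℝ) < (k : ℝ) + a + 1 := by have : (0 : ℝ) ≤ k := k.cast_nonneg; linarith
    have h := (Real.hasDerivAt_rpow_const (x := y) (p := (k : ℝ) + (a + 1))
      (Or.inl hy0.ne')).div_const (Real.Gamma ((k : ℝ) + (a + 1) + 1))
    refine h.congr_deriv ?_
    rw [← add_assoc, Real.Gamma_add_one hk.ne', add_sub_cancel_right]
    have := (gpos ha k).ne'
    field_simp
  · intro k y hy
    have hy0 : 0 < y := by linarith [hy.1]
    have hg := gpos ha k
    rw [Real.norm_of_nonneg (div_nonneg (Real.rpow_nonneg hy0.le _) hg.le), ← add_div]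
    refine div_le_div_of_nonneg_right ?_ hg.le
    have h1 := Real.rpow_nonneg (show (0 : ℝ) ≤ x / 2 by linarith) ((k : ℝ) + a)
    have h2 := Real.rpow_nonneg (show (0 : ℝ) ≤ 2 * x by linarith) ((k : ℝ) + a)
    rcases le_total 0 ((k : ℝ) + a) with h | h
    · have := Real.rpow_le_rpow hy0.le hy.2.le h
      linarith
    · have := Real.rpow_le_rpow_of_nonpos (show 0 < x / 2 by linarith) hy.1.le h
      linarith

lemma beta_half {b ξ : ℝ} (hb : -1 < b) (hξ : 0 < ξ) :
    ∫ t in (0 : ℝ)..ξ, (ξ - t) ^ (-(1 : ℝ) / 2) * t ^ b =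
      ξ ^ (b + 1 / 2) * (Real.Gamma (b + 1) * Real.Gamma (1 / 2) / Real.Gamma (b + 1 / 2 + 1)) := by
  apply Complex.ofReal_injective
  rw [← intervalIntegral.integral_ofReal]
  have h := Complex.betaIntegral_scaled ((b + 1 : ℝ) : ℂ) ((1 / 2 : ℝ) : ℂ) hξ
  rw [Complex.betaIntegral_eq_Gamma_mul_div _ _ (by simp; linarith) (by simp)] at h
  rw [← Complex.ofReal_add, Complex.Gamma_ofReal, Complex.Gamma_ofReal, Complex.Gamma_ofReal] at h
  have e : ((b + 1 + 1 / 2 : ℝ) : ℂ) - 1 = ((b + 1 / 2 : ℝ) : ℂ) := by push_cast; ring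
  rw [e, ← Complex.ofReal_cpow hξ.le] at h
  have e2 : b + 1 + 1 / 2 = b + 1 / 2 + 1 := by ring
  rw [e2] at h
  push_cast
  push_cast at h
  rw [← h]
  refine intervalIntegral.integral_congr fun t ht => ?_
  rw [Set.uIcc_of_le hξ.le] at ht
  rw [Complex.ofReal_cpow (by linarith [ht.2]), Complex.ofReal_cpow ht.1,
    mul_comm]
  congr 2
  · push_cast; ring
  · push_cast; ring
  · push_cast; ring

lemma EE_integral {a ξ : ℝ} (ha : -1 < a) (hξ : 0 < ξ) :
    ∫ t in (0 : ℝ)..ξ, (ξ - t) ^ (-(1 : ℝ) / 2) * EE a t =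
      Real.Gamma (1 / 2) * EE (a + 1 / 2) ξ := by
  have hG : 0 < Real.Gamma (1 / 2) := Real.Gamma_pos_of_pos (by norm_num)
  set F : ℕ → ℝ → ℝ := fun k t =>
    (ξ - t) ^ (-(1 : ℝ) / 2) * (t ^ ((k : ℝ) + a) / Real.Gamma ((k : ℝ) + a + 1)) with hF
  have hI : ∀ k, ∫ t in Set.Ioc 0 ξ, F k t =
      Real.Gamma (1 / 2) *
        (ξ ^ ((k : ℝ) + (a + 1 / 2)) / Real.Gamma ((k : ℝ) + (a + 1 / 2) + 1)) := by
    intro k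
    rw [← intervalIntegral.integral_of_le hξ.le]
    simp only [hF, ← mul_div_assoc]
    have hk : (-1 : ℝ) < (k : ℝ) + a := by have : (0 : ℝ) ≤ k := k.cast_nonneg; linarith
    rw [intervalIntegral.integral_div, beta_half hk hξ, ← add_assoc]
    have := (gpos ha k).ne'
    field_simp
  have hpos : ∀ k : ℕ, 0 < Real.Gamma (1 / 2) *
        (ξ ^ ((k : ℝ) + (a + 1 / 2)) / Real.Gamma ((k : ℝ) + (a + 1 / 2) + 1)) := fun k =>
    mul_pos hG (div_pos (Real.rpow_pos_of_pos hξ _) (gpos (by linarith) k))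
  have hint : ∀ k, Integrable (F k) (volume.restrict (Set.Ioc 0 ξ)) := by
    intro k
    by_contra h
    have := hI k
    rw [integral_undef h] at this
    exact (hpos k).ne this
  have hnorm : ∀ k, ∫ t in Set.Ioc 0 ξ, ‖F k t‖ = ∫ t in Set.Ioc 0 ξ, F k t := by
    intro k
    refine setIntegral_congr_fun measurableSet_Ioc fun t ht => ?_
    exact Real.norm_of_nonneg (mul_nonneg (Real.rpow_nonneg (by linarith [ht.2]) _)
      (div_nonneg (Real.rpow_nonneg ht.1.le _) (gpos ha k).le))
  have hs : Summable fun k => ∫ t in Set.Ioc 0 ξ, ‖F k t‖ := by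
    simp_rw [hnorm, hI]
    exact (EE_summable (by linarith) hξ).mul_left _
  have h := (hasSum_integral_of_summable_integral_norm hint hs).tsum_eq
  rw [intervalIntegral.integral_of_le hξ.le]
  simp_rw [hI, hF, tsum_mul_left] at h
  exact h.symm

lemma EE_integrable {a ξ : ℝ} (ha : -1 < a) (hξ : 0 < ξ) :
    IntervalIntegrable (fun t => (ξ - t) ^ (-(1 : ℝ) / 2) * EE a t) volume 0 ξ := by
  by_contra h
  have h1 := EE_integral ha hξ
  rw [intervalIntegral.integral_undef h] at h1
  exact (mul_pos (Real.Gamma_pos_of_pos (by norm_num)) (EE_pos (by linarith) hξ)).ne h1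

lemma Vstar_eq (x : ℝ) : Vstar x = (Real.exp x - 1) - EE (3 / 2) x := by
  have h := NormedSpace.expSeries_div_hasSum_exp x
  rw [← Real.exp_eq_exp_ℝ] at h
  have h2 := h.summable.tsum_eq_zero_add
  rw [h.tsum_eq] at h2
  simp only [pow_zero, Nat.factorial_zero, Nat.cast_one, div_one] at h2
  rw [Vstar, EE, h2, add_sub_cancel_left]
  congr 1
  refine tsum_congr fun k => ?_
  congr 2 <;> ring

lemma Vstar_d1 {x : ℝ} (hx : 0 < x) : HasDerivAt Vstar (EE 0 x - EE (1 / 2) x) x := by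
  rw [EE_zero]
  have h := ((Real.hasDerivAt_exp x).sub_const 1).sub
    (EE_hasDerivAt (a := 1 / 2) (by norm_num) hx)
  refine h.congr_of_eventuallyEq (Eventually.of_forall fun y => ?_)
  rw [Vstar_eq]
  norm_num

lemma Vstar_d2 {x : ℝ} (hx : 0 < x) : deriv (deriv Vstar) x = EE 0 x - EE (-1 / 2) x := by
  have h := (Real.hasDerivAt_exp x).sub (EE_hasDerivAt (a := -1 / 2) (by norm_num) hx)
  rw [EE_zero, ← h.deriv]
  refine EventuallyEq.deriv_eq ?_
  filter_upwards [lt_mem_nhds hx] with y hy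
  rw [(Vstar_d1 hy).deriv, EE_zero]
  norm_num

lemma EE_at_zero : EE (3 / 2) 0 = 0 := by
  rw [EE]
  convert tsum_zero with k
  rw [Real.zero_rpow (by positivity), zero_div]

lemma EE_bound {x : ℝ} (hx : 0 < x) (hx1 : x ≤ 1) :
    EE (3 / 2) x ≤ EE (3 / 2) 1 * x ^ (3 / 2 : ℝ) := by
  rw [EE, EE, ← tsum_mul_right]
  refine (EE_summable (by norm_num) hx).tsum_le_tsum (fun k => ?_)
    ((EE_summable (by norm_num) one_pos).mul_right _)
  rw [Real.one_rpow, div_mul_eq_mul_div, one_mul]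
  refine div_le_div_of_nonneg_right ?_ (gpos (by norm_num) k).le
  exact Real.rpow_le_rpow_of_exponent_ge hx hx1 (by simp)

lemma EE_d0 : HasDerivWithinAt (EE (3 / 2)) 0 (Set.Ici 0) 0 := by
  have h := (Real.hasDerivAt_rpow_const (x := 0) (p := 3 / 2)
    (Or.inr (by norm_num))).hasDerivWithinAt (s := Set.Ici 0)
  rw [Real.zero_rpow (by norm_num), mul_zero, hasDerivWithinAt_iff_isLittleO] at h
  rw [hasDerivWithinAt_iff_isLittleO]
  refine Asymptotics.IsBigO.trans_isLittleO ?_ h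
  refine Asymptotics.IsBigO.of_bound (EE (3 / 2) 1) ?_
  have h1 : ∀ᶠ y : ℝ in 𝓝[Set.Ici 0] 0, y < 1 :=
    mem_nhdsWithin_of_mem_nhds (gt_mem_nhds one_pos)
  filter_upwards [h1, self_mem_nhdsWithin] with y hy hy0
  simp only [EE_at_zero, smul_zero, sub_zero]
  rw [Real.zero_rpow (by norm_num), sub_zero]
  rcases (Set.mem_Ici.1 hy0).eq_or_lt with rfl | hlt
  · rw [EE_at_zero, Real.zero_rpow (by norm_num)]; simp
  · rw [Real.norm_of_nonneg (EE_pos (by norm_num) hlt).le,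
      Real.norm_of_nonneg (Real.rpow_nonneg hlt.le _)]
    exact EE_bound hlt hy.le


/-- `V*_{1/2}` solves the Caputo fractional IVP
`D^{3/2}_* V + V' = 0`, `V(0) = 0`, `V'(0) = 1` (right derivative at `0`),
with `D^{3/2}_* V(ξ) = (1/Γ(1/2)) ∫_0^ξ (ξ−t)^{−1/2} V''(t) dt`. -/
theorem stmt_10 :
    (∀ ξ > (0 : ℝ),
      (1 / Real.Gamma (1 / 2)) *
          (∫ t in (0 : ℝ)..ξ, (ξ - t) ^ (-(1 : ℝ) / 2) * deriv (deriv Vstar) t) +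
        deriv Vstar ξ = 0) ∧
      Vstar 0 = 0 ∧ derivWithin Vstar (Set.Ici 0) 0 = 1 := by

  refine ⟨fun ξ hξ => ?_, ?_, ?_⟩
  · have hG : Real.Gamma (1 / 2) ≠ 0 := (Real.Gamma_pos_of_pos (by norm_num)).ne'
    have hI : (∫ t in (0 : ℝ)..ξ, (ξ - t) ^ (-(1 : ℝ) / 2) * deriv (deriv Vstar) t) =
        ∫ t in (0 : ℝ)..ξ, ((ξ - t) ^ (-(1 : ℝ) / 2) * EE 0 t -
          (ξ - t) ^ (-(1 : ℝ) / 2) * EE (-1 / 2) t) := by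
      rw [intervalIntegral.integral_of_le hξ.le, intervalIntegral.integral_of_le hξ.le]
      refine setIntegral_congr_fun measurableSet_Ioc fun t ht => ?_
      simp only [Vstar_d2 ht.1, mul_sub]
    rw [hI, intervalIntegral.integral_sub (EE_integrable (by norm_num) hξ)
      (EE_integrable (by norm_num) hξ), EE_integral (by norm_num) hξ,
      EE_integral (by norm_num) hξ, (Vstar_d1 hξ).deriv]
    rw [show (-1 / 2 + 1 / 2 : ℝ) = 0 by norm_num, zero_add]
    field_simp
    ring
  · rw [Vstar_eq, EE_at_zero]; simp
  · have h := (((Real.hasDerivAt_exp 0).sub_const 1).hasDerivWithinAt (s := Set.Ici 0)).sub EE_d0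
    rw [Real.exp_zero, sub_zero] at h
    refine HasDerivWithinAt.derivWithin (h.congr (fun y _ => ?_) ?_)
      (uniqueDiffOn_Ici 0 0 Set.self_mem_Ici)
    · simp [Vstar_eq]
    · simp [Vstar_eq]
end

section
/- The function W = W₀ − W₁ satisfies the Caputo fractional equation D^{3/2}_* W(ξ) = W(ξ) for all ξ > 0, together with the initial conditions W(0) = 1 and W'(0) = −1 (the derivative at 0 taken from the right). Here D^{3/2}_* W(ξ) is the explicit integral (1/Γ(1/2)) ∫_0^ξ (ξ − t)^{−1/2} W''(t) dt. (W is the layer component V⁰ at x = 0, with θ = −1, of the reaction–diffusion problem for α = 1/2.) -/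
/-- `W₀(ξ) = Σ_{k=0}^∞ ξ^{3k/2}/Γ(3k/2 + 1)` (real powers `Real.rpow`). -/
noncomputable def W0 (ξ : ℝ) : ℝ :=
  ∑' k : ℕ, ξ ^ (3 * (k : ℝ) / 2) / Real.Gamma (3 * (k : ℝ) / 2 + 1)

/-- `W₁(ξ) = Σ_{k=0}^∞ ξ^{3k/2+1}/Γ(3k/2 + 2)` (real powers `Real.rpow`). -/
noncomputable def W1 (ξ : ℝ) : ℝ :=
  ∑' k : ℕ, ξ ^ (3 * (k : ℝ) / 2 + 1) / Real.Gamma (3 * (k : ℝ) / 2 + 2)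

/-- `W = W₀ − W₁`. -/
noncomputable def W (ξ : ℝ) : ℝ := W0 ξ - W1 ξ

noncomputable def gt (c x : ℝ) (k : ℕ) : ℝ := x ^ (3 * (k : ℝ) / 2 + c) / Real.Gamma (3 * (k : ℝ) / 2 + c + 1)
noncomputable def GG (c x : ℝ) : ℝ := ∑' k : ℕ, gt c x k

lemma gt_summable (c x : ℝ) (hx : 0 < x) : Summable (gt c x) := by
  have h1 : Filter.Tendsto (fun k : ℕ => 3 * (k : ℝ) / 2 + c + 1) Filter.atTop Filter.atTop := by
    have := (tendsto_natCast_atTop_atTop (R := ℝ)).const_mul_atTop (r := 3/2) (by norm_num)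
    refine (Filter.tendsto_atTop_add_const_right _ (c+1) this).congr fun k => by ring
  have ev := h1.eventually_ge_atTop 2
  refine summable_of_ratio_norm_eventually_le (r := 1/2) (by norm_num) ?_
  filter_upwards [ev, h1.eventually_ge_atTop (2 * x ^ (3/2:ℝ))] with k hk hk2
  set s := 3 * (k : ℝ) / 2 + c + 1 with hs
  have e1 : 3 * ((k+1 : ℕ) : ℝ) / 2 + c = (3 * (k : ℝ) / 2 + c) + 3/2 := by push_cast; ring
  have e2 : (3 * (k : ℝ) / 2 + c) + 3/2 + 1 = s + 3/2 := by rw [hs]; ring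
  have hG : 0 < Real.Gamma s := Real.Gamma_pos_of_pos (by linarith)
  have hG2 : s * Real.Gamma s ≤ Real.Gamma (s + 3/2) := by
    rw [← Real.Gamma_add_one (by linarith)]
    exact Real.Gamma_strictMonoOn_Ici.monotoneOn (by simp; linarith) (by simp; linarith) (by linarith)
  have hG3 : 0 < Real.Gamma (s+3/2) := Real.Gamma_pos_of_pos (by linarith)
  unfold gt
  rw [e1, e2, ← hs, Real.rpow_add hx, Real.norm_of_nonneg (by positivity), Real.norm_of_nonneg (by positivity)]
  have hp : 0 < x ^ (3 * (k : ℝ) / 2 + c) := by positivity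
  rw [div_le_iff₀ hG3]
  calc _ ≤ x ^ (3 * (k : ℝ) / 2 + c) * (s / 2) := by gcongr; linarith
    _ = 1 / 2 * (x ^ (3 * (k : ℝ) / 2 + c) / Real.Gamma s) * (s * Real.Gamma s) := by field_simp
    _ ≤ _ := by gcongr

lemma gt_deriv (c x : ℝ) (k : ℕ) (hx : 0 < x) : HasDerivAt (fun y => gt c y k) (gt (c-1) x k) x := by
  unfold gt
  set a := 3 * (k : ℝ) / 2 + c with ha
  have e : 3 * (k : ℝ) / 2 + (c-1) = a - 1 := by rw [ha]; ring
  rw [e, sub_add_cancel]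
  have h := (Real.hasDerivAt_rpow_const (x := x) (p := a) (Or.inl hx.ne')).div_const (Real.Gamma (a+1))
  have e2 : x ^ (a - 1) / Real.Gamma a = a * x ^ (a - 1) / Real.Gamma (a + 1) := by
    by_cases h0 : a = 0
    · simp [h0]
    · rw [Real.Gamma_add_one h0, mul_div_mul_left _ _ h0]
  rw [e2]
  exact h

lemma GG_deriv (c x : ℝ) (hx : 0 < x) : HasDerivAt (GG c) (GG (c-1) x) x := by
  have hs : Summable fun k => ‖gt (c-1) (x/2) k‖ + ‖gt (c-1) (2*x) k‖ :=
    (gt_summable _ _ (by positivity)).norm.add (gt_summable _ _ (by positivity)).norm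
  refine hasDerivAt_tsum_of_isPreconnected hs (isOpen_Ioo (a := x/2) (b := 2*x)) isPreconnected_Ioo
    (g := fun k y => gt c y k) (g' := fun k y => gt (c-1) y k) (y₀ := x) (y := x)
    (fun k y hy => gt_deriv c y k (by linarith [hy.1])) ?_ ?_ (gt_summable c x hx) ?_
  · intro k y hy
    have hy0 : 0 < y := by linarith [hy.1]
    unfold gt
    rw [norm_div, norm_div, norm_div, ← add_div]
    gcongr
    rw [Real.norm_of_nonneg (by positivity), Real.norm_of_nonneg (by positivity), Real.norm_of_nonneg (by positivity)]
    rcases le_total 0 (3 * (k : ℝ) / 2 + (c-1)) with h | h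
    · have := Real.rpow_le_rpow hy0.le hy.2.le h
      have : 0 < (x/2) ^ (3 * (k : ℝ) / 2 + (c-1)) := by positivity
      linarith
    · have := Real.rpow_le_rpow_of_nonpos (by positivity) hy.1.le h
      have : 0 < (2*x) ^ (3 * (k : ℝ) / 2 + (c-1)) := by positivity
      linarith
  · constructor <;> linarith
  · constructor <;> linarith

lemma W_eq : W = fun x => GG 0 x - GG 1 x := by
  funext x
  unfold W W0 W1 GG gt
  congr 1
  · simp
  · congr 1; funext k; congr 2; ring

lemma GG_shift (c x : ℝ) (hS : Summable (gt c x)) : GG c x = gt c x 0 + GG (c+3/2) x := by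
  unfold GG
  rw [hS.tsum_eq_zero_add]
  congr 2; funext k; unfold gt
  have e : 3 * ((k+1 : ℕ) : ℝ) / 2 + c = (3 * (k : ℝ) / 2 + (c + 3/2)) := by push_cast; ring
  rw [e]

lemma W_deriv2 (x : ℝ) (hx : 0 < x) : deriv (deriv W) x = GG (-1/2) x - GG (1/2) x := by
  have h1 : ∀ y, 0 < y → HasDerivAt W (GG (-1) y - GG 0 y) y := by
    intro y hy
    rw [W_eq]
    have a := GG_deriv 0 y hy
    have b := GG_deriv 1 y hy
    norm_num at a b
    exact a.sub b
  have h2 : deriv W =ᶠ[nhds x] fun y => GG (-1) y - GG 0 y := by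
    filter_upwards [lt_mem_nhds hx] with y hy using (h1 y hy).deriv
  rw [h2.deriv_eq]
  have a := GG_deriv (-1) x hx
  have b := GG_deriv 0 x hx
  have hd := (a.sub b).deriv
  have e := GG_shift (-1-1) x (gt_summable _ _ hx)
  have e' := GG_shift (0-1) x (gt_summable _ _ hx)
  have z : gt (-1-1) x 0 = 0 := by
    unfold gt
    have : Real.Gamma (3 * ((0:ℕ) : ℝ) / 2 + (-1-1) + 1) = 0 := by
      have := Real.Gamma_neg_nat_eq_zero 1
      norm_num at this ⊢; exact this
    rw [this, div_zero]
  have z' : gt (0-1) x 0 = 0 := by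
    unfold gt; norm_num
  rw [z] at e; rw [z'] at e'
  have hd' : deriv (fun y => GG (-1) y - GG 0 y) x = GG (-1 - 1) x - GG (0 - 1) x := hd
  rw [hd', e, e']; norm_num

lemma beta_real (a ξ : ℝ) (ha : -1 < a) (hξ : 0 < ξ) :
    ∫ t in (0:ℝ)..ξ, (ξ - t) ^ (-(1 : ℝ) / 2) * (t ^ a / Real.Gamma (a+1)) =
      Real.Gamma (1/2) * (ξ ^ (a + 1/2) / Real.Gamma (a + 1/2 + 1)) := by
  have h := Complex.betaIntegral_scaled ((a+1 : ℝ) : ℂ) ((1/2 : ℝ) : ℂ) hξ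
  have hb := Complex.Gamma_mul_Gamma_eq_betaIntegral (s := ((a+1 : ℝ) : ℂ)) (t := ((1/2 : ℝ) : ℂ))
    (by rw [Complex.ofReal_re]; linarith) (by rw [Complex.ofReal_re]; norm_num)
  have hG : 0 < Real.Gamma (a+1) := Real.Gamma_pos_of_pos (by linarith)
  have hG' : 0 < Real.Gamma (a+1+1/2) := Real.Gamma_pos_of_pos (by linarith)
  have hB : Complex.betaIntegral ((a+1 : ℝ) : ℂ) ((1/2 : ℝ) : ℂ) =
      ((Real.Gamma (a+1) * Real.Gamma (1/2) / Real.Gamma (a+1+1/2) : ℝ) : ℂ) := by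
    rw [← Complex.ofReal_add, Complex.Gamma_ofReal, Complex.Gamma_ofReal, Complex.Gamma_ofReal] at hb
    push_cast at hb ⊢
    rw [hb]
    have : (Real.Gamma (a+1+1/2) : ℂ) ≠ 0 := by exact_mod_cast hG'.ne'
    rw [mul_div_cancel_left₀ _ this]
  have hI : ∫ x in (0:ℝ)..ξ, (x:ℂ) ^ (((a+1:ℝ):ℂ) - 1) * ((ξ:ℂ) - x) ^ (((1/2:ℝ):ℂ) - 1) =
      ((∫ t in (0:ℝ)..ξ, (ξ - t) ^ (-(1 : ℝ) / 2) * t ^ a : ℝ) : ℂ) := by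
    rw [← intervalIntegral.integral_ofReal]
    refine intervalIntegral.integral_congr fun t ht => ?_
    rw [Set.uIcc_of_le hξ.le] at ht
    have e1 : (((a+1:ℝ):ℂ) - 1) = (a : ℂ) := by push_cast; ring
    have e2 : (((1/2:ℝ):ℂ) - 1) = ((-(1:ℝ)/2 : ℝ) : ℂ) := by push_cast; ring
    rw [e1, e2, ← Complex.ofReal_sub, ← Complex.ofReal_cpow ht.1, ← Complex.ofReal_cpow (by linarith [ht.2])]
    push_cast; ring
  have e3 : (((a+1:ℝ):ℂ) + ((1/2:ℝ):ℂ) - 1) = ((a + 1/2 : ℝ) : ℂ) := by push_cast; ring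
  rw [hI, hB, e3, ← Complex.ofReal_cpow hξ.le, ← Complex.ofReal_mul] at h
  have h' := Complex.ofReal_injective h
  simp only [← mul_div_assoc]
  rw [intervalIntegral.integral_div, h']
  have e4 : a + 1/2 + 1 = a + 1 + 1/2 := by ring
  rw [e4]
  field_simp

lemma int_gt (c ξ : ℝ) (k : ℕ) (hc : -1 < c) (hξ : 0 < ξ) :
    ∫ t in (0:ℝ)..ξ, (ξ - t) ^ (-(1 : ℝ) / 2) * gt c t k = Real.Gamma (1/2) * gt (c+1/2) ξ k := by
  unfold gt
  rw [beta_real _ _ (by have : (0:ℝ) ≤ k := by positivity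
                        linarith) hξ, add_assoc (3 * (k:ℝ)/2)]

lemma int_gt_integrable (c ξ : ℝ) (k : ℕ) (hc : -1 < c) (hξ : 0 < ξ) :
    IntervalIntegrable (fun t => (ξ - t) ^ (-(1 : ℝ) / 2) * gt c t k) MeasureTheory.volume 0 ξ := by
  by_contra h
  have h1 := intervalIntegral.integral_undef h
  rw [int_gt c ξ k hc hξ] at h1
  have : 0 < Real.Gamma (1/2) * gt (c+1/2) ξ k := by
    unfold gt
    have h1 : 0 < Real.Gamma (3 * (k:ℝ)/2 + (c+1/2) + 1) := Real.Gamma_pos_of_pos (by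
      have : (0:ℝ) ≤ k := by positivity
      linarith)
    have h2 : 0 < Real.Gamma (1/2) := Real.Gamma_pos_of_pos (by norm_num)
    positivity
  linarith

lemma int_GG (c ξ : ℝ) (hc : -1 < c) (hξ : 0 < ξ) :
    (IntervalIntegrable (fun t => (ξ - t) ^ (-(1 : ℝ) / 2) * GG c t) MeasureTheory.volume 0 ξ) ∧
    ∫ t in (0:ℝ)..ξ, (ξ - t) ^ (-(1 : ℝ) / 2) * GG c t = Real.Gamma (1/2) * GG (c+1/2) ξ := by
  have hG : ∀ k : ℕ, 0 < Real.Gamma (3 * (k:ℝ)/2 + c + 1) := fun k => Real.Gamma_pos_of_pos (by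
      have : (0:ℝ) ≤ k := by positivity
      linarith)
  have h2 : 0 < Real.Gamma (1/2) := Real.Gamma_pos_of_pos (by norm_num)
  have key := MeasureTheory.hasSum_integral_of_summable_integral_norm
    (μ := MeasureTheory.volume.restrict (Set.Ioc 0 ξ))
    (F := fun (k:ℕ) t => (ξ - t) ^ (-(1 : ℝ) / 2) * gt c t k)
    (fun k => (intervalIntegrable_iff_integrableOn_Ioc_of_le hξ.le).1 (int_gt_integrable c ξ k hc hξ)) ?_
  · have e : ∀ k : ℕ, ∫ t in Set.Ioc 0 ξ, (ξ - t) ^ (-(1 : ℝ) / 2) * gt c t k = Real.Gamma (1/2) * gt (c+1/2) ξ k := by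
      intro k
      rw [← int_gt c ξ k hc hξ, intervalIntegral.integral_of_le hξ.le]
    simp only [e, tsum_mul_left] at key
    have heq := key.unique ((gt_summable (c+1/2) ξ hξ).hasSum.mul_left (Real.Gamma (1/2)))
    have hval : ∫ t in (0:ℝ)..ξ, (ξ - t) ^ (-(1 : ℝ) / 2) * GG c t = Real.Gamma (1/2) * GG (c+1/2) ξ := by
      rw [intervalIntegral.integral_of_le hξ.le]; exact heq
    refine ⟨?_, hval⟩
    by_contra h
    have h1 := intervalIntegral.integral_undef h
    rw [hval] at h1
    have hk : ∀ k, 0 < gt (c+1/2) ξ k := by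
      intro k
      unfold gt
      have h1 : 0 < Real.Gamma (3 * (k:ℝ)/2 + (c+1/2) + 1) := Real.Gamma_pos_of_pos (by
        have : (0:ℝ) ≤ k := by positivity
        linarith)
      positivity
    have : 0 < GG (c+1/2) ξ := (gt_summable (c+1/2) ξ hξ).tsum_pos (fun k => (hk k).le) 0 (hk 0)
    have := mul_pos h2 this
    linarith
  · refine ((gt_summable (c+1/2) ξ hξ).mul_left (Real.Gamma (1/2))).congr fun k => ?_
    rw [← int_gt c ξ k hc hξ, intervalIntegral.integral_of_le hξ.le]
    refine MeasureTheory.setIntegral_congr_fun measurableSet_Ioc fun t ht => ?_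
    have a1 : 0 ≤ ξ - t := by linarith [ht.2]
    have a2 : 0 ≤ t := ht.1.le
    have := hG k
    rw [Real.norm_of_nonneg]
    unfold gt
    positivity

lemma GG_zero (c : ℝ) (hc : 0 < c) : GG c 0 = 0 := by
  unfold GG gt
  have : ∀ k : ℕ, (0:ℝ) ^ (3 * (k : ℝ) / 2 + c) = 0 := fun k => Real.zero_rpow (by positivity)
  simp [this]

lemma gt_summable_zero (c : ℝ) : Summable (gt c 0) := by
  refine summable_of_ratio_norm_eventually_le (r := 1/2) (by norm_num) ?_
  have h1 : Filter.Tendsto (fun k : ℕ => 3 * (k : ℝ) / 2 + c) Filter.atTop Filter.atTop := by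
    have := (tendsto_natCast_atTop_atTop (R := ℝ)).const_mul_atTop (r := 3/2) (by norm_num)
    refine (Filter.tendsto_atTop_add_const_right _ c this).congr fun k => by ring
  filter_upwards [h1.eventually_gt_atTop 0] with k hk
  unfold gt
  rw [Real.zero_rpow (x := 3 * ((k+1:ℕ) : ℝ) / 2 + c) (by push_cast; linarith)]
  simp only [zero_div, norm_zero]; positivity

lemma GG_right (c : ℝ) (hc : 1 < c) : HasDerivWithinAt (GG c) 0 (Set.Ici 0) 0 := by
  rw [hasDerivWithinAt_iff_tendsto_slope]
  have hb : ∀ x ∈ Set.Ioo (0:ℝ) 1, ‖slope (GG c) 0 x‖ ≤ x ^ (c-1) * GG c 1 := by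
    intro x hx
    have hx0 := hx.1
    have hG : ∀ k : ℕ, 0 < Real.Gamma (3 * (k:ℝ)/2 + c + 1) := fun k => Real.Gamma_pos_of_pos (by positivity)
    have h0 : 0 ≤ GG c x := tsum_nonneg fun k => by
      have := hG k
      unfold gt; positivity
    have h1 : GG c x ≤ x ^ c * GG c 1 := by
      unfold GG
      rw [← tsum_mul_left]
      refine (gt_summable c x hx0).tsum_le_tsum (fun k => ?_) ((gt_summable c 1 one_pos).mul_left _)
      have := hG k
      unfold gt
      rw [Real.one_rpow, mul_one_div]
      gcongr ?_ / _
      exact Real.rpow_le_rpow_of_exponent_ge hx0 hx.2.le (by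
        have : (0:ℝ) ≤ k := by positivity
        linarith)
    rw [slope_def_field, GG_zero c (by linarith), sub_zero, sub_zero, Real.norm_of_nonneg (by positivity),
      div_le_iff₀ hx0]
    refine h1.trans_eq ?_
    rw [Real.rpow_sub_one hx0.ne']; field_simp
  have hset : Set.Ici (0:ℝ) \ {0} = Set.Ioi 0 := by
    ext x; simp [lt_iff_le_and_ne, eq_comm]
  rw [hset]
  refine squeeze_zero_norm' (a := fun x => x ^ (c-1) * GG c 1) ?_ ?_
  · filter_upwards [Ioo_mem_nhdsGT (zero_lt_one (α := ℝ))] with x hx using hb x hx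
  · have : ContinuousAt (fun x : ℝ => x ^ (c-1) * GG c 1) 0 :=
      (Real.continuousAt_rpow_const 0 (c-1) (.inr (by linarith))).mul_const _
    have t := this.tendsto
    simp only [Real.zero_rpow (by linarith : c - 1 ≠ 0), zero_mul] at t
    exact t.mono_left nhdsWithin_le_nhds

lemma W_split (x : ℝ) (hx : 0 ≤ x) : W x = 1 + GG (3/2) x - (x + GG (5/2) x) := by
  have hS : ∀ c, Summable (gt c x) := fun c => by
    rcases hx.eq_or_lt with h | h
    · rw [← h]; exact gt_summable_zero c
    · exact gt_summable c x h
  have e (c : ℝ) : GG c x = gt c x 0 + GG (c+3/2) x := by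
    unfold GG
    rw [(hS c).tsum_eq_zero_add]
    congr 2; funext k; unfold gt
    have e : 3 * ((k+1 : ℕ) : ℝ) / 2 + c = (3 * (k : ℝ) / 2 + (c + 3/2)) := by push_cast; ring
    rw [e]
  rw [W_eq]
  simp only
  rw [e 0, e 1]
  have h2 : Real.Gamma (1 + 1) = 1 := by norm_num
  simp only [gt]
  norm_num

theorem stmt_13 :
    (∀ ξ > (0 : ℝ),
      (1 / Real.Gamma (1 / 2)) *
          (∫ t in (0 : ℝ)..ξ, (ξ - t) ^ (-(1 : ℝ) / 2) * deriv (deriv W) t) = W ξ) ∧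
      W 0 = 1 ∧ derivWithin W (Set.Ici 0) 0 = -1 := by
  have hW0 : W 0 = 1 := by
    rw [W_split 0 le_rfl, GG_zero _ (by norm_num), GG_zero _ (by norm_num)]; norm_num
  refine ⟨fun ξ hξ => ?_, hW0, ?_⟩
  · have h2 : 0 < Real.Gamma (1/2) := Real.Gamma_pos_of_pos (by norm_num)
    obtain ⟨i1, v1⟩ := int_GG (-1/2) ξ (by norm_num) hξ
    obtain ⟨i2, v2⟩ := int_GG (1/2) ξ (by norm_num) hξ
    have e : ∫ t in (0 : ℝ)..ξ, (ξ - t) ^ (-(1 : ℝ) / 2) * deriv (deriv W) t =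
        ∫ t in (0 : ℝ)..ξ, ((ξ - t) ^ (-(1 : ℝ) / 2) * GG (-1/2) t - (ξ - t) ^ (-(1 : ℝ) / 2) * GG (1/2) t) := by
      rw [intervalIntegral.integral_of_le hξ.le, intervalIntegral.integral_of_le hξ.le]
      refine MeasureTheory.setIntegral_congr_fun measurableSet_Ioc fun t ht => ?_
      rw [W_deriv2 t ht.1]; ring
    rw [e, intervalIntegral.integral_sub i1 i2, v1, v2, W_eq]
    have e1 : (-1/2 + 1/2 : ℝ) = 0 := by norm_num
    have e2 : (1/2 + 1/2 : ℝ) = 1 := by norm_num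
    rw [e1, e2]
    field_simp
  · have h := ((GG_right (3/2) (by norm_num)).const_add 1).sub
      ((hasDerivWithinAt_id (0:ℝ) (Set.Ici 0)).add (GG_right (5/2) (by norm_num)))
    have h' : HasDerivWithinAt W (0 - (1 + 0)) (Set.Ici 0) 0 :=
      h.congr (fun x hx => W_split x hx) (W_split 0 le_rfl)
    rw [h'.derivWithin (uniqueDiffOn_Ici 0 0 (by simp))]
    norm_num
end

section
/- As ε → 0⁺, the quantity μ(ε) = W(ε^{−2/3}) satisfies lim_{ε→0⁺} μ(ε)/ε^{1/3} = 1/√π, where W = W₀ − W₁. In particular μ = O(ε^{1/3}) = O(ε^{(1−α)/(2−α)}) for α = 1/2, which is the value at x = 1 of the layer component V⁰ of the reaction–diffusion problem in the stretched variable ξ = x/ε^{2/3}. -/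
open Filter Topology Set

/-- Generic series `E_b(ξ) = Σ ξ^{3k/2+b}/Γ(3k/2+b+1)`. -/
noncomputable def serE (b ξ : ℝ) : ℝ :=
  ∑' k : ℕ, ξ ^ (3 * (k : ℝ) / 2 + b) / Real.Gamma (3 * (k : ℝ) / 2 + b + 1)

lemma gamma_lower {s M : ℝ} (hs : 0 ≤ s) (hM : 0 < M) :
    M ^ s * Real.exp (-M) ≤ Real.Gamma (s + 1) := by
  rw [Real.Gamma_eq_integral (by linarith), ← integral_exp_neg_Ioi M,
    ← MeasureTheory.integral_const_mul]
  have hint := Real.GammaIntegral_convergent (s := s + 1) (by linarith)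
  have hsub : Ioi M ⊆ Ioi (0 : ℝ) := Ioi_subset_Ioi hM.le
  calc ∫ x in Ioi M, M ^ s * Real.exp (-x)
      ≤ ∫ x in Ioi M, Real.exp (-x) * x ^ (s + 1 - 1) := by
        apply MeasureTheory.setIntegral_mono_on
        · exact (integrableOn_exp_neg_Ioi M).const_mul _
        · exact hint.mono_set hsub
        · exact measurableSet_Ioi
        · intro x hx
          have hx' : M < x := hx
          rw [add_sub_cancel_right, mul_comm]
          have : M ^ s ≤ x ^ s := Real.rpow_le_rpow hM.le hx'.le hs
          gcongr
    _ ≤ _ := by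
        apply MeasureTheory.setIntegral_mono_set hint
        · refine (MeasureTheory.ae_restrict_iff' measurableSet_Ioi).2 (Eventually.of_forall ?_)
          intro x hx
          have hx' : 0 < x := hx
          simp only [Pi.zero_apply]
          positivity
        · exact hsub.eventuallyLE

lemma term_bound {s R : ℝ} (hs : 0 ≤ s) (hR : 0 < R) :
    R ^ s / Real.Gamma (s + 1) ≤ Real.exp (2 * R) * (1 / 2 : ℝ) ^ s := by
  have h := gamma_lower hs (M := 2 * R) (by linarith)
  have hG : 0 < Real.Gamma (s + 1) := Real.Gamma_pos_of_pos (by linarith)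
  rw [div_le_iff₀ hG]
  calc R ^ s = Real.exp (2 * R) * (1 / 2 : ℝ) ^ s * ((2 * R) ^ s * Real.exp (-(2 * R))) := by
        have h1 : (1 / 2 : ℝ) ^ s * (2 * R) ^ s = R ^ s := by
          rw [← Real.mul_rpow (by norm_num) (by linarith)]; congr 1; ring
        have h2 : Real.exp (2 * R) * Real.exp (-(2 * R)) = 1 := by
          rw [← Real.exp_add]; simp
        calc R ^ s = (Real.exp (2 * R) * Real.exp (-(2 * R))) * ((1 / 2 : ℝ) ^ s * (2 * R) ^ s) := by
              rw [h1, h2, one_mul]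
          _ = _ := by ring
    _ ≤ _ := by gcongr

lemma serE_summable {b ξ : ℝ} (hb : 0 ≤ b) (hξ : 0 < ξ) :
    Summable fun k : ℕ => ξ ^ (3 * (k : ℝ) / 2 + b) / Real.Gamma (3 * (k : ℝ) / 2 + b + 1) := by
  have hs : Summable fun k : ℕ => Real.exp (2 * ξ) * (((1 / 2 : ℝ) ^ (3 / 2 : ℝ)) ^ k *
      (1 / 2 : ℝ) ^ b) := by
    apply Summable.mul_left
    apply Summable.mul_right
    apply summable_geometric_of_lt_one (by positivity)
    exact Real.rpow_lt_one (by norm_num) (by norm_num) (by norm_num)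
  refine Summable.of_nonneg_of_le (fun k => ?_) (fun k => ?_) hs
  · have : 0 < Real.Gamma (3 * (k : ℝ) / 2 + b + 1) := Real.Gamma_pos_of_pos (by positivity)
    positivity
  · have := term_bound (s := 3 * (k : ℝ) / 2 + b) (by positivity) hξ
    refine this.trans (le_of_eq ?_)
    rw [Real.rpow_add (by norm_num), ← Real.rpow_natCast, ← Real.rpow_mul (by norm_num)]
    congr 3
    ring_nf

lemma serE_succ {b ξ : ℝ} (hb : 0 ≤ b) (hξ : 0 < ξ) :
    serE b ξ = ξ ^ b / Real.Gamma (b + 1) + serE (b + 3 / 2) ξ := by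
  unfold serE
  rw [(serE_summable hb hξ).tsum_eq_zero_add]
  congr 1
  · simp
  · congr 1
    ext k
    push_cast
    ring_nf

lemma serE_hasDerivAt {b ξ : ℝ} (hb : 1 ≤ b) (hξ : 0 < ξ) :
    HasDerivAt (serE b) (serE (b - 1) ξ) ξ := by
  have hm : ξ ∈ Ioo 0 (ξ + 1) := ⟨hξ, by linarith⟩
  refine hasDerivAt_tsum_of_isPreconnected
    (g := fun (k : ℕ) (x : ℝ) => x ^ (3 * (k : ℝ) / 2 + b) / Real.Gamma (3 * (k : ℝ) / 2 + b + 1))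
    (g' := fun (k : ℕ) (x : ℝ) =>
      x ^ (3 * (k : ℝ) / 2 + (b - 1)) / Real.Gamma (3 * (k : ℝ) / 2 + (b - 1) + 1))
    (serE_summable (b := b - 1) (ξ := ξ + 1) (by linarith) (by linarith))
    isOpen_Ioo isPreconnected_Ioo ?_ ?_ hm (serE_summable (by linarith) hξ) hm
  · intro k x hx
    have hx0 : 0 < x := hx.1
    have hk : (0 : ℝ) ≤ 3 * (k : ℝ) / 2 := by positivity
    have h := (Real.hasDerivAt_rpow_const (x := x) (p := 3 * (k : ℝ) / 2 + b)
      (Or.inl hx0.ne')).div_const (Real.Gamma (3 * (k : ℝ) / 2 + b + 1))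
    refine h.congr_deriv ?_
    have hp : 3 * (k : ℝ) / 2 + b ≠ 0 := by linarith
    rw [Real.Gamma_add_one hp, mul_div_mul_left _ _ hp]
    congr 2 <;> ring
  · intro k x hx
    have hx0 : 0 < x := hx.1
    have hk : (0 : ℝ) ≤ 3 * (k : ℝ) / 2 := by positivity
    have : 0 < Real.Gamma (3 * (k : ℝ) / 2 + (b - 1) + 1) := Real.Gamma_pos_of_pos (by linarith)
    rw [Real.norm_of_nonneg (by positivity)]
    have := Real.rpow_le_rpow hx0.le hx.2.le (z := 3 * (k : ℝ) / 2 + (b - 1)) (by linarith)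
    gcongr

lemma W0_eq : W0 = serE 0 := by
  ext ξ; unfold W0 serE; simp

lemma W1_eq : W1 = serE 1 := by
  ext ξ; unfold W1 serE
  congr 1; ext k; ring_nf

lemma W1_deriv {ξ : ℝ} (hξ : 0 < ξ) : HasDerivAt W1 (W0 ξ) ξ := by
  rw [W1_eq, W0_eq]
  simpa using serE_hasDerivAt (b := 1) le_rfl hξ

lemma W0_deriv {ξ : ℝ} (hξ : 0 < ξ) : HasDerivAt W0 (serE (1 / 2) ξ) ξ := by
  rw [W0_eq]
  have h := (serE_hasDerivAt (b := 3 / 2) (by norm_num) hξ).const_add 1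
  have e : (3 / 2 : ℝ) - 1 = 1 / 2 := by norm_num
  rw [e] at h
  refine h.congr_of_eventuallyEq ?_
  filter_upwards [Ioi_mem_nhds hξ] with x hx
  rw [serE_succ le_rfl hx]
  simp

lemma W2_deriv {ξ : ℝ} (hξ : 0 < ξ) :
    HasDerivAt (serE (1 / 2)) (ξ ^ (-(1 / 2) : ℝ) / Real.sqrt Real.pi + W1 ξ) ξ := by
  rw [W1_eq]
  have h := ((Real.hasDerivAt_rpow_const (x := ξ) (p := 1 / 2)
      (Or.inl hξ.ne')).div_const (Real.Gamma (1 / 2 + 1))).add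
      (serE_hasDerivAt (b := 2) (by norm_num) hξ)
  have e : (2 : ℝ) - 1 = 1 := by norm_num
  rw [e] at h
  have h2 := h.congr_of_eventuallyEq (f₁ := serE (1 / 2)) (by
    filter_upwards [Ioi_mem_nhds hξ] with x hx
    rw [serE_succ (by norm_num) hx]
    norm_num)
  refine h2.congr_deriv ?_
  rw [Real.Gamma_add_one (by norm_num), Real.Gamma_one_half_eq, mul_div_mul_left _ _ (by norm_num)]
  norm_num

/-- A simple Gronwall-type decay lemma. -/
lemma decay {U U' h : ℝ → ℝ} {a X₀ : ℝ} (ha : 0 < a) (hU0 : ∀ x, X₀ ≤ x → 0 ≤ U x)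
    (hU : ∀ x, X₀ ≤ x → HasDerivAt U (U' x) x)
    (hle : ∀ x, X₀ ≤ x → U' x ≤ -a * U x + h x) (hh : Tendsto h atTop (𝓝 0)) :
    Tendsto U atTop (𝓝 0) := by
  rw [tendsto_order]
  refine ⟨fun c hc => ?_, fun c hc => ?_⟩
  · filter_upwards [eventually_ge_atTop X₀] with x hx
    exact hc.trans_le (hU0 x hx)
  · have hη : 0 < a * c / 2 := by positivity
    obtain ⟨X₁, hX₁⟩ := eventually_atTop.1 (hh.eventually (gt_mem_nhds hη))
    set X := max X₀ X₁
    have hd : ∀ x, X₀ ≤ x → HasDerivAt (fun x => Real.exp (a * x) * (U x - c / 2))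
        (Real.exp (a * x) * a * (U x - c / 2) + Real.exp (a * x) * U' x) x := by
      intro x hx
      have h1 : HasDerivAt (fun x => Real.exp (a * x)) (Real.exp (a * x) * a) x := by
        simpa using ((hasDerivAt_id x).const_mul a).exp
      exact h1.mul ((hU x hx).sub_const _)
    have hanti : AntitoneOn (fun x => Real.exp (a * x) * (U x - c / 2)) (Ici X) := by
      apply antitoneOn_of_deriv_nonpos (convex_Ici X)
      · intro x hx
        exact (hd x ((le_max_left _ _).trans hx)).continuousAt.continuousWithinAt
      · intro x hx
        rw [interior_Ici] at hx
        exact (hd x ((le_max_left _ _).trans (le_of_lt hx))).differentiableAt.differentiableWithinAt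
      · intro x hx
        rw [interior_Ici] at hx
        have hx0 : X₀ ≤ x := (le_max_left _ _).trans (le_of_lt hx)
        have hx1 : X₁ ≤ x := (le_max_right _ _).trans (le_of_lt hx)
        rw [(hd x hx0).deriv]
        have e1 := hle x hx0
        have e2 := hX₁ x hx1
        have : Real.exp (a * x) * a * (U x - c / 2) + Real.exp (a * x) * U' x
          = Real.exp (a * x) * (a * U x - a * c / 2 + U' x) := by ring
        rw [this]
        exact mul_nonpos_of_nonneg_of_nonpos (Real.exp_pos _).le (by linarith)
    set K := Real.exp (a * X) * (U X - c / 2)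
    have hlim : Tendsto (fun x => K * Real.exp (-(a * x))) atTop (𝓝 0) := by
      have : Tendsto (fun x => a * x) atTop atTop := tendsto_id.const_mul_atTop ha
      simpa using (Real.tendsto_exp_neg_atTop_nhds_zero.comp this).const_mul K
    have hc2 : (0 : ℝ) < c / 2 := by positivity
    filter_upwards [hlim.eventually (gt_mem_nhds hc2), eventually_ge_atTop X] with x hx hxX
    have h1 : Real.exp (a * x) * (U x - c / 2) ≤ K := hanti (mem_Ici.2 le_rfl) hxX hxX
    have h2 : U x - c / 2 ≤ K * Real.exp (-(a * x)) := by
      rw [Real.exp_neg, ← div_eq_mul_inv, le_div_iff₀ (Real.exp_pos _)]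
      linarith
    linarith

lemma main_lim : Tendsto (fun ξ : ℝ => ξ ^ (1 / 2 : ℝ) * W ξ) atTop
    (𝓝 (1 / Real.sqrt Real.pi)) := by
  set κ := 1 / Real.sqrt Real.pi with hκ
  let y : ℝ → ℝ := fun ξ => W ξ - κ * ξ ^ (-(1 / 2) : ℝ)
  let y1 : ℝ → ℝ := fun ξ => serE (1 / 2) ξ - W0 ξ + κ / 2 * ξ ^ (-(3 / 2) : ℝ)
  let g : ℝ → ℝ := fun ξ => κ / 2 * ξ ^ (-(3 / 2) : ℝ) - 3 / 4 * κ * ξ ^ (-(5 / 2) : ℝ)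
  have hy : ∀ ξ, 0 < ξ → HasDerivAt y (y1 ξ) ξ := by
    intro ξ hξ
    have h := ((W0_deriv hξ).sub (W1_deriv hξ)).sub ((Real.hasDerivAt_rpow_const (x := ξ)
      (p := -(1 / 2)) (Or.inl hξ.ne')).const_mul κ)
    refine h.congr_deriv ?_
    have e : (-(1 / 2) - 1 : ℝ) = -(3 / 2) := by norm_num
    simp only [y1, e]
    ring
  have hy1 : ∀ ξ, 0 < ξ → HasDerivAt y1 (-(y1 ξ) - y ξ + g ξ) ξ := by
    intro ξ hξ
    have h := ((W2_deriv hξ).sub (W0_deriv hξ)).add ((Real.hasDerivAt_rpow_const (x := ξ)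
      (p := -(3 / 2)) (Or.inl hξ.ne')).const_mul (κ / 2))
    refine h.congr_deriv ?_
    have e : (-(3 / 2) - 1 : ℝ) = -(5 / 2) := by norm_num
    simp only [y1, y, g, e, W, hκ]
    ring
  let V : ℝ → ℝ := fun ξ => y ξ ^ 2 + y ξ * y1 ξ + y1 ξ ^ 2
  have hV : ∀ ξ, 0 < ξ → HasDerivAt V (-(V ξ) + (y ξ + 2 * y1 ξ) * g ξ) ξ := by
    intro ξ hξ
    have h := (((hy ξ hξ).pow 2).add ((hy ξ hξ).mul (hy1 ξ hξ))).add ((hy1 ξ hξ).pow 2)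
    refine h.congr_deriv ?_
    simp only [V]
    push_cast
    ring
  have hU : Tendsto (fun ξ => ξ * V ξ) atTop (𝓝 0) := by
    refine decay (a := 1 / 4) (X₀ := 4) (h := fun ξ => 2 * (ξ * g ξ ^ 2))
      (U' := fun ξ => 1 * V ξ + ξ * (-(V ξ) + (y ξ + 2 * y1 ξ) * g ξ)) (by norm_num) ?_ ?_ ?_ ?_
    · intro x hx
      have : 0 ≤ V x := by
        simp only [V]; nlinarith [sq_nonneg (y x + y1 x), sq_nonneg (y x), sq_nonneg (y1 x)]
      positivity
    · intro x hx
      exact (hasDerivAt_id x).mul (hV x (by linarith))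
    · intro x hx
      have h1 : (y x + 2 * y1 x) ^ 2 ≤ 4 * V x := by
        simp only [V]; nlinarith [sq_nonneg (y x)]
      have h0 : 0 ≤ V x := by nlinarith [sq_nonneg (y x + 2 * y1 x)]
      have h2 : (y x + 2 * y1 x) * g x ≤ V x / 2 + 2 * g x ^ 2 := by
        nlinarith [sq_nonneg ((y x + 2 * y1 x) - 4 * g x)]
      have h3 := mul_le_mul_of_nonneg_left h2 (show (0 : ℝ) ≤ x by linarith)
      nlinarith [mul_le_mul_of_nonneg_right hx h0]
    · have h1 : Tendsto (fun ξ : ℝ => 2 * (κ / 2 * ξ ^ (-1 : ℝ) - 3 / 4 * κ * ξ ^ (-2 : ℝ)) ^ 2)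
          atTop (𝓝 (2 * (κ / 2 * 0 - 3 / 4 * κ * 0) ^ 2)) :=
        ((((tendsto_rpow_neg_atTop (y := 1) (by norm_num)).const_mul _).sub
          ((tendsto_rpow_neg_atTop (y := 2) (by norm_num)).const_mul _)).pow 2).const_mul 2
      have h2 : (2 * (κ / 2 * 0 - 3 / 4 * κ * 0) ^ 2 : ℝ) = 0 := by ring
      rw [h2] at h1
      refine h1.congr' ?_
      filter_upwards [eventually_gt_atTop 0] with x hx
      have e1 : x ^ (-1 : ℝ) = x ^ (1 / 2 : ℝ) * x ^ (-(3 / 2) : ℝ) := by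
        rw [← Real.rpow_add hx]; norm_num
      have e2 : x ^ (-2 : ℝ) = x ^ (1 / 2 : ℝ) * x ^ (-(5 / 2) : ℝ) := by
        rw [← Real.rpow_add hx]; norm_num
      have e3 : x ^ (1 / 2 : ℝ) * x ^ (1 / 2 : ℝ) = x := by
        rw [← Real.rpow_add hx]; norm_num
      rw [e1, e2]
      simp only [g]
      linear_combination (2 * (κ / 2 * x ^ (-(3 / 2) : ℝ) - 3 / 4 * κ * x ^ (-(5 / 2) : ℝ)) ^ 2) * e3
  have hz : Tendsto (fun ξ : ℝ => ξ ^ (1 / 2 : ℝ) * y ξ) atTop (𝓝 0) := by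
    have hb : Tendsto (fun ξ => Real.sqrt (4 / 3 * (ξ * V ξ))) atTop (𝓝 0) := by
      simpa using (hU.const_mul (4 / 3)).sqrt
    refine squeeze_zero_norm' ?_ hb
    filter_upwards [eventually_gt_atTop 0] with x hx
    apply Real.le_sqrt_of_sq_le
    have e3 : x ^ (1 / 2 : ℝ) * x ^ (1 / 2 : ℝ) = x := by
      rw [← Real.rpow_add hx]; norm_num
    have : ‖x ^ (1 / 2 : ℝ) * y x‖ ^ 2 = x * y x ^ 2 := by
      rw [Real.norm_eq_abs, sq_abs]
      linear_combination (y x ^ 2) * e3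
    rw [this]
    have : y x ^ 2 ≤ 4 / 3 * V x := by
      simp only [V]; nlinarith [sq_nonneg (y x + 2 * y1 x)]
    nlinarith
  have h := hz.add_const κ
  rw [zero_add] at h
  refine h.congr' ?_
  filter_upwards [eventually_gt_atTop 0] with x hx
  have e : x ^ (1 / 2 : ℝ) * x ^ (-(1 / 2) : ℝ) = 1 := by
    rw [← Real.rpow_add hx]; norm_num
  simp only [y]
  linear_combination (-κ) * e

/-- `μ(ε) = W(ε^{−2/3})` satisfies `μ(ε)/ε^{1/3} → 1/√π` as `ε → 0⁺`;
in particular `μ = O(ε^{1/3})`. -/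
theorem stmt_15 :
    Filter.Tendsto (fun ε : ℝ => W (ε ^ (-(2 : ℝ) / 3)) / ε ^ ((1 : ℝ) / 3))
      (nhdsWithin 0 (Set.Ioi 0)) (nhds (1 / Real.sqrt Real.pi)) := by
  have h1 : Filter.Tendsto (fun ε : ℝ => ε ^ (-(2 : ℝ) / 3)) (nhdsWithin 0 (Set.Ioi 0))
      Filter.atTop := tendsto_rpow_neg_nhdsGT_zero (by norm_num)
  refine (main_lim.comp h1).congr' ?_
  filter_upwards [self_mem_nhdsWithin] with x hx
  have hx : 0 < x := hx
  simp only [Function.comp]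
  have e : (-(2 : ℝ) / 3 * (1 / 2)) = -(1 / 3) := by norm_num
  rw [← Real.rpow_mul hx.le, e, Real.rpow_neg hx.le, mul_comm, ← div_eq_mul_inv]
end

section
/- The function W₀ satisfies the Caputo fractional equation D^{3/2}_* W₀(ξ) = W₀(ξ) for all ξ > 0, with W₀(0) = 1 and W₀'(0) = 0 (the derivative at 0 taken from the right), where D^{3/2}_* W₀(ξ) = (1/Γ(1/2)) ∫_0^ξ (ξ − t)^{−1/2} W₀''(t) dt; moreover, as ξ → ∞, e^{−ξ}·W₀(ξ) tends to 2/3. -/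
open MeasureTheory Filter Topology

noncomputable def pw (s t : ℝ) : ℝ := t ^ s / Real.Gamma (s + 1)

lemma pw_hasDerivAt (s : ℝ) {t : ℝ} (ht : 0 < t) : HasDerivAt (pw s) (pw (s - 1) t) t := by
  unfold pw
  by_cases hs : s = 0
  · subst hs
    simp only [Real.rpow_zero, zero_sub, neg_add_cancel, Real.Gamma_zero, div_zero]
    exact hasDerivAt_const _ _
  · have := (Real.hasDerivAt_rpow_const (x := t) (p := s) (Or.inl ht.ne')).div_const
      (Real.Gamma (s + 1))
    have e : t ^ (s - 1) / Real.Gamma (s - 1 + 1) = s * t ^ (s - 1) / Real.Gamma (s + 1) := by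
      rw [Real.Gamma_add_one hs, sub_add_cancel, mul_div_mul_left _ _ hs]
    rw [e]; exact this

lemma pw_succ (s : ℝ) {t : ℝ} (ht : 0 < t) (hs : s + 1 ≠ 0) :
    pw (s + 1) t = t / (s + 1) * pw s t := by
  unfold pw
  rw [Real.Gamma_add_one hs, Real.rpow_add_one ht.ne']
  rw [div_mul_div_comm, mul_comm t]

lemma pw_summable_nat (c : ℝ) {t : ℝ} (ht : 0 < t) : Summable fun n : ℕ => pw (n + c) t := by
  apply summable_of_ratio_norm_eventually_le (r := 1 / 2) (by norm_num)
  filter_upwards [eventually_ge_atTop (⌈2 * t + |c|⌉₊)] with n hn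
  have h1 : 2 * t + |c| ≤ n := (Nat.le_ceil _).trans (by exact_mod_cast hn)
  have h2 := neg_abs_le c
  have h3 : 0 < (n : ℝ) + c + 1 := by linarith
  have : ((n + 1 : ℕ) : ℝ) + c = (n + c) + 1 := by push_cast; ring
  rw [this, pw_succ _ ht h3.ne', norm_mul]
  gcongr
  rw [Real.norm_of_nonneg (by positivity), div_le_iff₀ h3]
  linarith

lemma pw_summable (c : ℝ) {t : ℝ} (ht : 0 < t) :
    Summable fun k : ℕ => pw (3 * (k : ℝ) / 2 + c) t := by
  have hinj : Function.Injective (fun j : ℕ => 3 * j) := fun a b h => by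
    simp only at h; omega
  have h1 := (pw_summable_nat c ht).comp_injective hinj
  have h2 := (pw_summable_nat (c + 3 / 2) ht).comp_injective hinj
  refine (HasSum.even_add_odd (m := ∑' j : ℕ, pw (((3 * j : ℕ) : ℝ) + c) t)
    (m' := ∑' j : ℕ, pw (((3 * j : ℕ) : ℝ) + (c + 3 / 2)) t) ?_ ?_).summable
  · convert! h1.hasSum using 3
    simp only [Function.comp]; push_cast; congr 1; ring
  · convert! h2.hasSum using 3
    simp only [Function.comp]; push_cast; congr 1; ring

lemma pw_bound (s : ℝ) {a b t : ℝ} (ha : 0 < a) (h1 : a ≤ t) (h2 : t ≤ b) :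
    ‖pw s t‖ ≤ ‖pw s a‖ + ‖pw s b‖ := by
  have ht := ha.trans_le h1
  have hb := ht.trans_le h2
  unfold pw
  rw [norm_div, norm_div, norm_div, ← add_div]
  gcongr
  rw [Real.norm_of_nonneg (by positivity), Real.norm_of_nonneg (by positivity),
    Real.norm_of_nonneg (by positivity)]
  have e1 : 0 < a ^ s := by positivity
  have e2 : 0 < b ^ s := by positivity
  rcases le_total 0 s with hs | hs
  · have := Real.rpow_le_rpow ht.le h2 hs
    linarith
  · have := Real.rpow_le_rpow_of_nonpos ha h1 hs
    linarith

lemma pw_tsum_hasDerivAt (c : ℝ) {t : ℝ} (ht : 0 < t) :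
    HasDerivAt (fun z => ∑' k : ℕ, pw (3 * (k : ℝ) / 2 + c) z)
      (∑' k : ℕ, pw (3 * (k : ℝ) / 2 + (c - 1)) t) t := by
  have ha : 0 < t / 2 := by linarith
  have hb : 0 < 2 * t := by linarith
  refine hasDerivAt_tsum_of_isPreconnected (t := Set.Ioo (t / 2) (2 * t)) (y₀ := t)
    (u := fun k : ℕ => ‖pw (3 * (k : ℝ) / 2 + (c - 1)) (t / 2)‖
      + ‖pw (3 * (k : ℝ) / 2 + (c - 1)) (2 * t)‖)
    ((pw_summable _ ha).norm.add (pw_summable _ hb).norm) isOpen_Ioo isPreconnected_Ioo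
    ?_ ?_ ?_ (pw_summable c ht) ?_
  · intro n y hy
    have := pw_hasDerivAt (3 * (n : ℝ) / 2 + c) (ha.trans hy.1)
    rwa [add_sub_assoc] at this
  · intro n y hy
    exact pw_bound _ ha hy.1.le hy.2.le
  · constructor <;> linarith
  · constructor <;> linarith

lemma W0_eq_s18 (t : ℝ) : W0 t = ∑' k : ℕ, pw (3 * (k : ℝ) / 2 + 0) t := by
  simp [W0, pw]

lemma W0_deriv2 {t : ℝ} (ht : 0 < t) :
    deriv (deriv W0) t = ∑' k : ℕ, pw (3 * (k : ℝ) / 2 - 1 / 2) t := by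
  have h0 : W0 = fun z => ∑' k : ℕ, pw (3 * (k : ℝ) / 2 + 0) z := funext W0_eq_s18
  have h1 : deriv W0 =ᶠ[𝓝 t] fun z => ∑' k : ℕ, pw (3 * (k : ℝ) / 2 + (0 - 1)) z := by
    filter_upwards [lt_mem_nhds ht] with z hz
    rw [h0]
    exact (pw_tsum_hasDerivAt 0 hz).deriv
  rw [h1.deriv_eq, (pw_tsum_hasDerivAt (0 - 1) ht).deriv,
    (pw_summable (0 - 1 - 1) ht).tsum_eq_zero_add]
  have h2 : pw (3 * ((0 : ℕ) : ℝ) / 2 + (0 - 1 - 1)) t = 0 := by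
    unfold pw
    have := Real.Gamma_neg_nat_eq_zero 1
    rw [show 3 * ((0 : ℕ) : ℝ) / 2 + (0 - 1 - 1) + 1 = -((1 : ℕ) : ℝ) by norm_num, this, div_zero]
  rw [h2, zero_add]
  congr 1; ext k; congr 1; push_cast; ring

lemma frac_pw (s : ℝ) (hs : -1 < s) {ξ : ℝ} (hξ : 0 < ξ) :
    ∫ t in (0 : ℝ)..ξ, (ξ - t) ^ (-(1 : ℝ) / 2) * pw s t = Real.Gamma (1 / 2) * pw (s + 1 / 2) ξ := by
  have h1 := Complex.betaIntegral_scaled ((s + 1 : ℝ) : ℂ) ((1 / 2 : ℝ) : ℂ) hξ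
  have h2 := Complex.Gamma_mul_Gamma_eq_betaIntegral (s := ((s + 1 : ℝ) : ℂ))
    (t := ((1 / 2 : ℝ) : ℂ)) (by simp; linarith) (by simp)
  have hG : 0 < Real.Gamma (s + 1 + 1 / 2) := Real.Gamma_pos_of_pos (by linarith)
  have hG' : 0 < Real.Gamma (s + 1) := Real.Gamma_pos_of_pos (by linarith)
  rw [← Complex.ofReal_add, Complex.Gamma_ofReal, Complex.Gamma_ofReal, Complex.Gamma_ofReal] at h2
  have h3 : ∫ (x : ℝ) in 0..ξ, (x : ℂ) ^ (((s + 1 : ℝ) : ℂ) - 1) * ((ξ : ℂ) - x) ^ (((1 / 2 : ℝ) : ℂ) - 1)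
      = ∫ (x : ℝ) in 0..ξ, (((x ^ s * (ξ - x) ^ (-(1 : ℝ) / 2) : ℝ)) : ℂ) := by
    apply intervalIntegral.integral_congr
    intro x hx
    rw [Set.uIcc_of_le hξ.le] at hx
    simp only
    rw [Complex.ofReal_mul, Complex.ofReal_cpow hx.1, Complex.ofReal_cpow (by linarith [hx.2])]
    congr 2
    · push_cast; ring
    · push_cast; rfl
    · push_cast; ring
  rw [h3, intervalIntegral.integral_ofReal] at h1
  have h4 : ((ξ : ℂ)) ^ (((s + 1 : ℝ) : ℂ) + ((1 / 2 : ℝ) : ℂ) - 1) = ((ξ ^ (s + 1 / 2) : ℝ) : ℂ) := by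
    rw [Complex.ofReal_cpow hξ.le]; congr 1; push_cast; ring
  rw [h4] at h1
  have h5 : (((∫ (x : ℝ) in 0..ξ, x ^ s * (ξ - x) ^ (-(1 : ℝ) / 2)) * Real.Gamma (s + 1 + 1 / 2) : ℝ) : ℂ)
      = ((ξ ^ (s + 1 / 2) * (Real.Gamma (s + 1) * Real.Gamma (1 / 2)) : ℝ) : ℂ) := by
    push_cast at h1 h2 ⊢
    rw [h1, h2]; ring
  have h6 := Complex.ofReal_injective h5
  have h7 : ∀ t, (ξ - t) ^ (-(1 : ℝ) / 2) * pw s t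
      = (t ^ s * (ξ - t) ^ (-(1 : ℝ) / 2)) / Real.Gamma (s + 1) := by
    intro t; unfold pw; ring
  simp_rw [h7]
  rw [intervalIntegral.integral_div]
  unfold pw
  rw [show s + 1 / 2 + 1 = s + 1 + 1 / 2 by ring]
  rw [div_eq_iff hG'.ne', mul_div_assoc', div_mul_eq_mul_div, eq_div_iff hG.ne', h6]
  ring

lemma pw_nonneg {s t : ℝ} (hs : -1 < s) (ht : 0 ≤ t) : 0 ≤ pw s t := by
  have hG' : 0 < Real.Gamma (s + 1) := Real.Gamma_pos_of_pos (by linarith)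
  unfold pw; positivity

lemma frac_sum (s : ℕ → ℝ) (hs : ∀ k, -1 < s k) {ξ : ℝ} (hξ : 0 < ξ)
    (hsum : Summable fun k => pw (s k + 1 / 2) ξ) :
    ∫ t in (0 : ℝ)..ξ, (ξ - t) ^ (-(1 : ℝ) / 2) * ∑' k, pw (s k) t
      = Real.Gamma (1 / 2) * ∑' k, pw (s k + 1 / 2) ξ := by
  have hH : 0 < Real.Gamma (1 / 2) := Real.Gamma_pos_of_pos (by norm_num)
  have hint : ∀ k, IntegrableOn (fun t => (ξ - t) ^ (-(1 : ℝ) / 2) * pw (s k) t) (Set.Ioc 0 ξ) := by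
    intro k
    rw [← intervalIntegrable_iff_integrableOn_Ioc_of_le hξ.le]
    by_contra h
    have h1 := intervalIntegral.integral_undef h
    rw [frac_pw _ (hs k) hξ] at h1
    have hG' : 0 < Real.Gamma (s k + 1 / 2 + 1) := Real.Gamma_pos_of_pos (by linarith [hs k])
    have : 0 < pw (s k + 1 / 2) ξ := by unfold pw; positivity
    have := mul_pos hH this
    linarith
  have hnorm : ∀ k, ∫ t in Set.Ioc 0 ξ, ‖(ξ - t) ^ (-(1 : ℝ) / 2) * pw (s k) t‖
      = Real.Gamma (1 / 2) * pw (s k + 1 / 2) ξ := by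
    intro k
    rw [← frac_pw _ (hs k) hξ, intervalIntegral.integral_of_le hξ.le]
    apply setIntegral_congr_fun measurableSet_Ioc
    intro t ht
    have h1 := pw_nonneg (hs k) ht.1.le
    have h2 : 0 ≤ ξ - t := by linarith [ht.2]
    exact Real.norm_of_nonneg (by positivity)
  have key := hasSum_integral_of_summable_integral_norm hint (by
    simp_rw [hnorm]; exact hsum.mul_left _)
  rw [intervalIntegral.integral_of_le hξ.le]
  simp_rw [← tsum_mul_left]
  rw [← key.tsum_eq]
  congr 1; ext k
  rw [← frac_pw _ (hs k) hξ, intervalIntegral.integral_of_le hξ.le]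

lemma caputo {ξ : ℝ} (hξ : 0 < ξ) : (1 / Real.Gamma (1 / 2)) *
    (∫ t in (0 : ℝ)..ξ, (ξ - t) ^ (-(1 : ℝ) / 2) * deriv (deriv W0) t) = W0 ξ := by
  have hH : 0 < Real.Gamma (1 / 2) := Real.Gamma_pos_of_pos (by norm_num)
  have h1 : ∫ t in (0 : ℝ)..ξ, (ξ - t) ^ (-(1 : ℝ) / 2) * deriv (deriv W0) t
      = ∫ t in (0 : ℝ)..ξ, (ξ - t) ^ (-(1 : ℝ) / 2) * ∑' k : ℕ, pw (3 * (k : ℝ) / 2 - 1 / 2) t := by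
    rw [intervalIntegral.integral_of_le hξ.le, intervalIntegral.integral_of_le hξ.le]
    apply setIntegral_congr_fun measurableSet_Ioc
    intro t ht
    simp only
    rw [W0_deriv2 ht.1]
  have h2 : ∀ k : ℕ, 3 * (k : ℝ) / 2 - 1 / 2 + 1 / 2 = 3 * (k : ℝ) / 2 + 0 := fun k => by ring
  rw [h1, frac_sum (fun k : ℕ => 3 * (k : ℝ) / 2 - 1 / 2) _ hξ]
  · simp_rw [h2]
    rw [← W0_eq_s18]; field_simp
  · simp_rw [h2]; exact pw_summable 0 hξ
  · intro k
    have : (0 : ℝ) ≤ k := k.cast_nonneg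
    linarith

lemma W0_zero : W0 0 = 1 := by
  unfold W0
  rw [tsum_eq_single 0]
  · simp
  · intro k hk
    rw [Real.zero_rpow (by positivity), zero_div]

lemma W0_deriv_zero : derivWithin W0 (Set.Ici 0) 0 = 0 := by
  apply HasDerivWithinAt.derivWithin _ (uniqueDiffOn_Ici 0 0 Set.self_mem_Ici)
  have hs1 : Summable fun k : ℕ => pw (3 * (k : ℝ) / 2 + 3 / 2) 1 := pw_summable _ one_pos
  set C := ∑' k : ℕ, pw (3 * (k : ℝ) / 2 + 3 / 2) 1 with hC
  have hb : ∀ t : ℝ, 0 < t → t ≤ 1 → |W0 t - 1| ≤ C * t ^ (3 / 2 : ℝ) := by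
    intro t ht ht1
    have e : W0 t - 1 = ∑' k : ℕ, pw (3 * (k : ℝ) / 2 + 3 / 2) t := by
      rw [W0_eq_s18, (pw_summable 0 ht).tsum_eq_zero_add]
      have : pw (3 * ((0 : ℕ) : ℝ) / 2 + 0) t = 1 := by simp [pw]
      rw [this, add_sub_cancel_left]
      congr 1; ext k; congr 1; push_cast; ring
    have hp : ∀ k : ℕ, (-1 : ℝ) < 3 * (k : ℝ) / 2 + 3 / 2 := fun k => by
      have : (0 : ℝ) ≤ k := k.cast_nonneg
      linarith
    rw [e, abs_of_nonneg (tsum_nonneg fun k => pw_nonneg (hp k) ht.le), hC, ← tsum_mul_right]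
    apply (pw_summable _ ht).tsum_le_tsum _ (hs1.mul_right _)
    intro k
    have hG' : 0 < Real.Gamma (3 * (k : ℝ) / 2 + 3 / 2 + 1) :=
      Real.Gamma_pos_of_pos (by linarith [hp k])
    unfold pw
    rw [Real.one_rpow, div_mul_eq_mul_div, one_mul]
    gcongr ?_ / _
    apply Real.rpow_le_rpow_of_exponent_ge ht ht1
    have : (0 : ℝ) ≤ k := k.cast_nonneg
    linarith
  rw [hasDerivWithinAt_iff_tendsto_slope]
  have hset : Set.Ici (0 : ℝ) \ {0} = Set.Ioi 0 := by
    ext x; simp [lt_iff_le_and_ne, eq_comm]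
  rw [hset]
  have hlim : Tendsto (fun t : ℝ => C * t ^ (1 / 2 : ℝ)) (𝓝[>] 0) (𝓝 0) := by
    have : ContinuousAt (fun t : ℝ => C * t ^ (1 / 2 : ℝ)) 0 :=
      continuousAt_const.mul (Real.continuousAt_rpow_const _ _ (Or.inr (by norm_num)))
    have h := this.tendsto.mono_left (nhdsWithin_le_nhds (s := Set.Ioi 0))
    simpa using h
  apply squeeze_zero_norm' _ hlim
  filter_upwards [Ioo_mem_nhdsGT (zero_lt_one (α := ℝ))] with t ht
  rw [slope_def_field, W0_zero, sub_zero, norm_div, Real.norm_eq_abs, Real.norm_of_nonneg ht.1.le,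
    div_le_iff₀ ht.1, mul_assoc, ← Real.rpow_add_one ht.1.ne']
  convert! hb t ht.1 ht.2.le using 3
  norm_num

noncomputable def om : ℂ := ⟨-1 / 2, Real.sqrt 3 / 2⟩

lemma om_sq : om ^ 2 = ⟨-1 / 2, -(Real.sqrt 3 / 2)⟩ := by
  have h : Real.sqrt 3 * Real.sqrt 3 = 3 := Real.mul_self_sqrt (by norm_num)
  apply Complex.ext
  · simp only [om, pow_two, Complex.mul_re]; linarith
  · simp only [om, pow_two, Complex.mul_im]; ring

lemma om_cube : om ^ 3 = 1 := by
  have h : Real.sqrt 3 * Real.sqrt 3 = 3 := Real.mul_self_sqrt (by norm_num)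
  rw [pow_succ, om_sq]
  apply Complex.ext
  · simp only [om, Complex.mul_re, Complex.one_re]; linarith
  · simp only [om, Complex.mul_im, Complex.one_im]; ring

lemma om_re (n : ℕ) : 1 + 2 * (om ^ n).re = if n % 3 = 0 then 3 else 0 := by
  conv_lhs => rw [← Nat.div_add_mod n 3, pow_add, pow_mul, om_cube, one_pow, one_mul]
  have : n % 3 = 0 ∨ n % 3 = 1 ∨ n % 3 = 2 := by omega
  rcases this with h | h | h <;> rw [h]
  · norm_num
  · norm_num [om]
  · rw [om_sq]; norm_num

noncomputable def Bf (r : ℕ) (t : ℝ) : ℝ :=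
  (Real.exp t + 2 * (om ^ r * Complex.exp (om * t)).re) / 3

lemma Bf_hasSum_aux (r : ℕ) (t : ℝ) :
    HasSum (fun n : ℕ => t ^ n / n.factorial * (if (n + r) % 3 = 0 then 1 else 0)) (Bf r t) := by
  have h1 : HasSum (fun n : ℕ => t ^ n / n.factorial) (Real.exp t) := by
    rw [Real.exp_eq_exp_ℝ]; exact NormedSpace.expSeries_div_hasSum_exp t
  have h2 : HasSum (fun n : ℕ => (om * t) ^ n / n.factorial) (Complex.exp (om * t)) := by
    rw [Complex.exp_eq_exp_ℂ]; exact NormedSpace.expSeries_div_hasSum_exp (om * t)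
  have h3 := Complex.hasSum_re (h2.mul_left (om ^ r))
  have h4 := (h1.add (h3.mul_left 2)).div_const 3
  unfold Bf
  convert! h4 using 2 with n
  have e : om ^ r * ((om * t) ^ n / n.factorial) = ((t ^ n / n.factorial : ℝ) : ℂ) * om ^ (n + r) := by
    push_cast; rw [mul_pow, pow_add]; ring
  rw [e, Complex.re_ofReal_mul]
  have := om_re (n + r)
  split_ifs at this ⊢
  · linear_combination (t ^ n / n.factorial) / 3 * (-this)
  · linear_combination (t ^ n / n.factorial) / 3 * (-this)

lemma Bf_hasSum (r q : ℕ) (hq : q < 3) (h : (q + r) % 3 = 0) (t : ℝ) :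
    HasSum (fun j : ℕ => t ^ (3 * j + q) / (3 * j + q).factorial) (Bf r t) := by
  have hinj : Function.Injective (fun j : ℕ => 3 * j + q) := fun a b h => by
    simp only at h; omega
  have := (hinj.hasSum_iff (f := fun n : ℕ => t ^ n / n.factorial * (if (n + r) % 3 = 0 then (1 : ℝ) else 0))
    (a := Bf r t) ?_).2 (Bf_hasSum_aux r t)
  · convert! this using 2 with j
    simp only [Function.comp]
    rw [if_pos (by omega), mul_one]
  · intro n hn
    rw [if_neg, mul_zero]
    intro h'
    exact hn ⟨n / 3, by simp only; omega⟩

lemma Bf_bound (r : ℕ) (t : ℝ) : |Real.exp (-t) * Bf r t - 1 / 3| ≤ 2 / 3 * Real.exp (-(3 / 2 * t)) := by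
  have hn : ‖om‖ = 1 := by
    have := congrArg norm om_cube
    rw [norm_pow, norm_one] at this
    exact (pow_eq_one_iff_of_nonneg (norm_nonneg _) (by norm_num)).1 this
  have h1 : |(om ^ r * Complex.exp (om * t)).re| ≤ Real.exp (-(t / 2)) := by
    refine (Complex.abs_re_le_norm _).trans ?_
    rw [norm_mul, norm_pow, hn, one_pow, one_mul, Complex.norm_exp]
    apply le_of_eq; congr 1
    simp [om]; ring
  have h2 : Real.exp (-t) * Bf r t - 1 / 3
      = 2 / 3 * (Real.exp (-t) * (om ^ r * Complex.exp (om * t)).re) := by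
    have : Real.exp (-t) * Real.exp t = 1 := by rw [← Real.exp_add]; simp
    unfold Bf; linear_combination this / 3
  rw [h2, abs_mul, abs_of_pos (by norm_num : (0 : ℝ) < 2 / 3), abs_mul, abs_of_pos (Real.exp_pos _)]
  rw [show -(3 / 2 * t) = -t + -(t / 2) by ring, Real.exp_add]
  gcongr

lemma Bf_cont (r : ℕ) : Continuous (Bf r) := by
  unfold Bf
  have : Continuous fun t : ℝ => om ^ r * Complex.exp (om * t) := by fun_prop
  have := Complex.continuous_re.comp this
  simp only [Function.comp_def] at this
  fun_prop

lemma Bf_le (r : ℕ) {t : ℝ} (ht : 0 ≤ t) : |Real.exp (-t) * Bf r t| ≤ 1 := by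
  have h := Bf_bound r t
  have h1 : Real.exp (-(3 / 2 * t)) ≤ 1 := Real.exp_le_one_iff.2 (by linarith)
  rw [abs_le] at h ⊢
  constructor <;> linarith

lemma Bf_tendsto (r : ℕ) : Tendsto (fun t => Real.exp (-t) * Bf r t) atTop (𝓝 (1 / 3)) := by
  rw [tendsto_iff_norm_sub_tendsto_zero]
  refine squeeze_zero (fun _ => norm_nonneg _) (Bf_bound r) ?_
  have h : Tendsto (fun t : ℝ => Real.exp (-(3 / 2 * t))) atTop (𝓝 0) :=
    Real.tendsto_exp_neg_atTop_nhds_zero.comp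
      (tendsto_id.const_mul_atTop (by norm_num : (0 : ℝ) < 3 / 2))
  simpa using h.const_mul (2 / 3)

lemma pw_nat (n : ℕ) (t : ℝ) : pw n t = t ^ n / n.factorial := by
  unfold pw; rw [Real.rpow_natCast, Real.Gamma_nat_eq_factorial]

lemma W0_split {ξ : ℝ} (hξ : 0 < ξ) : W0 ξ = Bf 0 ξ + (1 / Real.Gamma (1 / 2)) *
    ∫ t in (0 : ℝ)..ξ, (ξ - t) ^ (-(1 : ℝ) / 2) * Bf 2 t := by
  have hH : 0 < Real.Gamma (1 / 2) := Real.Gamma_pos_of_pos (by norm_num)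
  have hinj : Function.Injective (fun j : ℕ => 3 * j) := fun a b h => by
    simp only at h; omega
  have hB : ∀ t, Bf 2 t = ∑' j : ℕ, pw (3 * j + 1) t := by
    intro t
    rw [← (Bf_hasSum 2 1 (by norm_num) (by norm_num) t).tsum_eq]
    congr 1; ext j; rw [← pw_nat]; push_cast; rfl
  have hs : Summable fun j : ℕ => pw (3 * j + 1 + 1 / 2) ξ := by
    convert! (pw_summable_nat (1 + 1 / 2) hξ).comp_injective hinj using 2 with j
    simp only [Function.comp]; push_cast; congr 1; ring
  simp_rw [hB]
  rw [frac_sum (fun j : ℕ => 3 * (j : ℝ) + 1) _ hξ hs, ← mul_assoc, one_div_mul_cancel hH.ne', one_mul,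
    W0_eq_s18]
  · refine (HasSum.even_add_odd (f := fun k : ℕ => pw (3 * (k : ℝ) / 2 + 0) ξ) ?_ ?_).tsum_eq
    · convert! Bf_hasSum 0 0 (by norm_num) (by norm_num) ξ using 2 with j
      rw [← pw_nat]; push_cast; congr 1; ring
    · convert! hs.hasSum using 2 with j
      push_cast; congr 1; ring
  · intro k
    have : (0 : ℝ) ≤ k := k.cast_nonneg
    linarith

lemma conv_tendsto : Tendsto (fun ξ : ℝ => Real.exp (-ξ) *
    ∫ t in (0 : ℝ)..ξ, (ξ - t) ^ (-(1 : ℝ) / 2) * Bf 2 t) atTop (𝓝 (Real.Gamma (1 / 2) * (1 / 3))) := by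
  have hG : Real.Gamma (1 / 2) * (1 / 3)
      = ∫ u in Set.Ioi (0 : ℝ), Real.exp (-u) * u ^ ((1 : ℝ) / 2 - 1) * (1 / 3) := by
    rw [Real.Gamma_eq_integral (by norm_num), integral_mul_const]
  rw [hG]
  have hlim : Tendsto (fun ξ : ℝ => ∫ u in Set.Ioi (0 : ℝ), (Set.Iic ξ).indicator
      (fun u => Real.exp (-u) * u ^ ((1 : ℝ) / 2 - 1) * (Real.exp (-(ξ - u)) * Bf 2 (ξ - u))) u) atTop
      (𝓝 (∫ u in Set.Ioi (0 : ℝ), Real.exp (-u) * u ^ ((1 : ℝ) / 2 - 1) * (1 / 3))) := by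
    apply tendsto_integral_filter_of_dominated_convergence
      (fun u => Real.exp (-u) * u ^ ((1 : ℝ) / 2 - 1))
    · refine Eventually.of_forall fun ξ => ?_
      apply AEStronglyMeasurable.indicator _ measurableSet_Iic
      apply Measurable.aestronglyMeasurable
      have := (Bf_cont 2).measurable
      fun_prop
    · refine Eventually.of_forall fun ξ => ?_
      filter_upwards [ae_restrict_mem measurableSet_Ioi] with u hu
      have hu' : (0 : ℝ) < u := hu
      by_cases h : u ∈ Set.Iic ξ
      · rw [Set.indicator_of_mem h, norm_mul, Real.norm_of_nonneg (by positivity), Real.norm_eq_abs]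
        have := Bf_le 2 (sub_nonneg.2 h)
        exact mul_le_of_le_one_right (by positivity) this
      · rw [Set.indicator_of_notMem h, norm_zero]; positivity
    · exact Real.GammaIntegral_convergent (by norm_num)
    · filter_upwards with u
      have h1 : Tendsto (fun ξ : ℝ => ξ - u) atTop atTop := tendsto_atTop_add_const_right _ _ tendsto_id
      have h2 := ((Bf_tendsto 2).comp h1).const_mul (Real.exp (-u) * u ^ ((1 : ℝ) / 2 - 1))
      refine h2.congr' ?_
      filter_upwards [eventually_ge_atTop u] with ξ hξ
      rw [Set.indicator_of_mem (show u ∈ Set.Iic ξ from hξ)]; rfl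
  refine hlim.congr' ?_
  filter_upwards [eventually_gt_atTop 0] with ξ hξ
  rw [setIntegral_indicator measurableSet_Iic, Set.Ioi_inter_Iic, ← intervalIntegral.integral_of_le hξ.le,
    ← intervalIntegral.integral_const_mul]
  have := intervalIntegral.integral_comp_sub_left (a := 0) (b := ξ)
    (fun t => Real.exp (-ξ) * ((ξ - t) ^ (-(1 : ℝ) / 2) * Bf 2 t)) ξ
  rw [sub_self, sub_zero] at this
  rw [← this]
  congr 1; ext u
  rw [sub_sub_cancel, show -ξ = -u + -(ξ - u) by ring, Real.exp_add]
  norm_num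
  ring

theorem stmt_18 :
    (∀ ξ > (0 : ℝ),
      (1 / Real.Gamma (1 / 2)) *
          (∫ t in (0 : ℝ)..ξ, (ξ - t) ^ (-(1 : ℝ) / 2) * deriv (deriv W0) t) = W0 ξ) ∧
      W0 0 = 1 ∧ derivWithin W0 (Set.Ici 0) 0 = 0 ∧
      Filter.Tendsto (fun ξ : ℝ => Real.exp (-ξ) * W0 ξ) Filter.atTop
        (nhds (2 / 3)) := by
  refine ⟨fun ξ hξ => caputo hξ, W0_zero, W0_deriv_zero, ?_⟩
  have hH : 0 < Real.Gamma (1 / 2) := Real.Gamma_pos_of_pos (by norm_num)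
  have h := (Bf_tendsto 0).add (conv_tendsto.const_mul (1 / Real.Gamma (1 / 2)))
  have e : 1 / 3 + 1 / Real.Gamma (1 / 2) * (Real.Gamma (1 / 2) * (1 / 3)) = 2 / 3 := by
    rw [← mul_assoc, one_div_mul_cancel hH.ne']; norm_num
  rw [e] at h
  refine h.congr' ?_
  filter_upwards [eventually_gt_atTop 0] with ξ hξ
  rw [W0_split hξ]; ring
end
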